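/- Integrated hypocoercivity estimate: Assume (A,B) satisfies the Kalman rank condition. Then there exists a constant C > 0, depending only on n, A, B, κ, such that every classical solution U of the linear partially dissipative system with initial datum U₀ = U(·,0) satisfies, for all t ≥ 0, ‖U(t)‖²_{H¹} + ∫₀ᵗ (‖U₂(τ)‖²_{L²} + ‖∂ₓU(τ)‖²_{L²}) dτ ≤ C‖U₀‖²_{H¹}. -/

import Mathlib

open MeasureTheory Matrix Finset

noncomputable section

/-- Index type for the block decomposition `ℝⁿ = ℝ^{n₁} × ℝ^{n₂}`. -/
abbrev Idx (n₁ n₂ : ℕ) := Fin n₁ ⊕ Fin n₂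

/-- The partially dissipative matrix `B = [[0,0],[0,D]]`. -/
def Bmat {n₁ n₂ : ℕ} (D : Matrix (Fin n₂) (Fin n₂) ℝ) :
    Matrix (Idx n₁ n₂) (Idx n₁ n₂) ℝ :=
  Matrix.fromBlocks 0 0 0 D

/-- The Kalman rank condition for the pair `(A,B)`: the only `y ∈ ℝⁿ` with
`B A^k y = 0` for all `k = 0,…,n−1` is `y = 0`. -/
def KalmanCondition {n₁ n₂ : ℕ} (A B : Matrix (Idx n₁ n₂) (Idx n₁ n₂) ℝ) : Prop :=
  ∀ y : Idx n₁ n₂ → ℝ, (∀ k < n₁ + n₂, (B * A ^ k).mulVec y = 0) → y = 0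

/-- Spatial derivative `∂ₓU(t,x)` (time is the first argument). -/
def pdx {E : Type*} [NormedAddCommGroup E] [NormedSpace ℝ E]
    (U : ℝ → ℝ → E) (t x : ℝ) : E :=
  deriv (fun y => U t y) x

/-- A classical solution of `∂ₜU + A ∂ₓU = −BU` on `ℝ × [0,∞)`:
a smooth function that is Schwartz in `x`, locally uniformly in `t ≥ 0`,
and solves the equation for `t ≥ 0`. -/
structure IsClassicalSolution {n₁ n₂ : ℕ} (A : Matrix (Idx n₁ n₂) (Idx n₁ n₂) ℝ)
    (D : Matrix (Fin n₂) (Fin n₂) ℝ) (U : ℝ → ℝ → Idx n₁ n₂ → ℝ) : Prop where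
  smooth : ContDiff ℝ (⊤ : ℕ∞) (fun p : ℝ × ℝ => U p.1 p.2)
  decay : ∀ (k m : ℕ) (T : ℝ), ∃ C : ℝ, ∀ t ∈ Set.Icc (0 : ℝ) T, ∀ x : ℝ,
      |x| ^ k * ‖iteratedDeriv m (fun y => U t y) x‖ ≤ C
  eqn : ∀ (t x : ℝ), 0 ≤ t →
      deriv (fun s => U s x) t + A.mulVec (pdx U t x) + (Bmat D).mulVec (U t x) = 0

/-- Squared `L²` norm of a vector-valued function on `ℝ`. -/
def sqL2 {ι : Type*} [Fintype ι] (f : ℝ → ι → ℝ) : ℝ := ∫ x, ∑ i, (f x i) ^ 2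

/-- Squared `H¹` norm. -/
def sqH1 {ι : Type*} [Fintype ι] (f : ℝ → ι → ℝ) : ℝ := sqL2 f + sqL2 (deriv f)

/-- Squared weighted `L²` norm `‖|x|^μ f‖²_{L²}`. -/
def wSqL2 {ι : Type*} [Fintype ι] (μ : ℝ) (f : ℝ → ι → ℝ) : ℝ :=
  ∫ x, |x| ^ (2 * μ) * ∑ i, (f x i) ^ 2

/-- The dissipated component `U₂(t)`. -/
def U2part {n₁ n₂ : ℕ} (U : ℝ → ℝ → Idx n₁ n₂ → ℝ) (t : ℝ) : ℝ → Fin n₂ → ℝ :=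
  fun x j => U t x (Sum.inr j)

/-- A positive semidefinite form that is definite on the eigenspaces of a diagonal matrix admits a
skew-symmetric compensator. -/
theorem exists_skew_compensator_diagonal {ι : Type*} [Fintype ι] [DecidableEq ι] (a : ι → ℝ)
    (S : Matrix ι ι ℝ) (hS : S.PosSemidef)
    (h : ∀ (l : ℝ) (w : ι → ℝ), diagonal a *ᵥ w = l • w → S *ᵥ w = 0 → w = 0) :
    ∃ K : Matrix ι ι ℝ, Kᵀ = -K ∧
      ∀ w : ι → ℝ, w ≠ 0 → 0 < w ⬝ᵥ (K * diagonal a) *ᵥ w + w ⬝ᵥ S *ᵥ w := by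
  have hsymm : ∀ i j, S j i = S i j := fun i j => by simpa using hS.isHermitian.apply i j
  refine ⟨Matrix.of fun i j => -2 * S i j / (a j - a i), ?_, ?_⟩
  · ext i j
    change -2 * S j i / (a i - a j) = -(-2 * S i j / (a j - a i))
    rw [hsymm i j, ← neg_sub (a j) (a i), div_neg]
  intro w hw
  set P : ℝ → ι → ℝ := fun l i => if a i = l then w i else 0 with hP
  have key : w ⬝ᵥ ((Matrix.of fun i j => -2 * S i j / (a j - a i)) * diagonal a) *ᵥ w
      + w ⬝ᵥ S *ᵥ w = ∑ l ∈ univ.image a, P l ⬝ᵥ S *ᵥ P l := by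
    have e1 : w ⬝ᵥ ((Matrix.of fun i j => -2 * S i j / (a j - a i)) * diagonal a) *ᵥ w
        = ∑ i, ∑ j, w i * (-2 * S i j / (a j - a i) * a j * w j) := by
      simp only [dotProduct, mulVec, mul_diagonal, of_apply, mul_sum]
    have e2 : ∑ i, ∑ j, w i * (-2 * S i j / (a j - a i) * a j * w j)
        = ∑ i, ∑ j, w i * (2 * S i j / (a j - a i) * a i * w j) := by
      rw [sum_comm]
      refine sum_congr rfl fun i _ => sum_congr rfl fun j _ => ?_
      rw [hsymm i j, ← neg_sub (a j) (a i), div_neg]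
      ring
    have e3 : w ⬝ᵥ S *ᵥ w = ∑ i, ∑ j, w i * (S i j * w j) := by
      simp only [dotProduct, mulVec, mul_sum]
    have e4 : ∑ l ∈ univ.image a, P l ⬝ᵥ S *ᵥ P l
        = ∑ i, ∑ j, if a i = a j then w i * (S i j * w j) else 0 := by
      simp only [dotProduct, mulVec, mul_sum]
      rw [sum_comm]
      refine sum_congr rfl fun i _ => ?_
      rw [sum_comm]
      refine sum_congr rfl fun j _ => ?_
      rw [sum_eq_single (a i)]
      · by_cases hij : a i = a j
        · simp [hP, hij]
        · simp [hP, hij, Ne.symm hij]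
      · intro l _ hl
        simp [hP, Ne.symm hl]
      · intro hi
        exact absurd (mem_image_of_mem a (mem_univ i)) hi
    have e5 : ∑ i, ∑ j, w i * (-2 * S i j / (a j - a i) * a j * w j)
        + ∑ i, ∑ j, w i * (2 * S i j / (a j - a i) * a i * w j)
        + 2 * ∑ i, ∑ j, w i * (S i j * w j)
        = 2 * ∑ i, ∑ j, if a i = a j then w i * (S i j * w j) else 0 := by
      simp only [mul_sum, ← sum_add_distrib]
      refine sum_congr rfl fun i _ => sum_congr rfl fun j _ => ?_
      by_cases hij : a i = a j
      · simp [hij]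
      · have : a j - a i ≠ 0 := sub_ne_zero.2 (Ne.symm hij)
        simp only [hij, if_false]
        field_simp
        ring
    linarith
  rw [key]
  have hnn : ∀ l, 0 ≤ P l ⬝ᵥ S *ᵥ P l := fun l => by
    simpa using hS.dotProduct_mulVec_nonneg (P l)
  obtain ⟨i, hi⟩ := Function.ne_iff.1 hw
  refine sum_pos' (fun l _ => hnn l) ⟨a i, mem_image_of_mem a (mem_univ i), ?_⟩
  refine lt_of_le_of_ne (hnn _) fun h0 => ?_
  have h1 : S *ᵥ P (a i) = 0 := (hS.dotProduct_mulVec_zero_iff _).1 (by simpa using h0.symm)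
  have h2 : P (a i) = 0 := h (a i) _ (by
    ext j
    by_cases hj : a j = a i <;> simp [mulVec_diagonal, hP, hj]) h1
  exact hi (by simpa [hP] using congrFun h2 i)

/-- Existence of a skew-symmetric compensator for a symmetric matrix and a positive semidefinite
matrix whose kernel contains no eigenvector of the former. -/
theorem exists_skew_compensator {ι : Type*} [Fintype ι] [DecidableEq ι] (A B : Matrix ι ι ℝ)
    (hA : A.IsSymm) (hB : B.PosSemidef)
    (h : ∀ (l : ℝ) (w : ι → ℝ), A *ᵥ w = l • w → B *ᵥ w = 0 → w = 0) :
    ∃ K : Matrix ι ι ℝ, Kᵀ = -K ∧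
      ∀ w : ι → ℝ, w ≠ 0 → 0 < w ⬝ᵥ (K * A) *ᵥ w + w ⬝ᵥ B *ᵥ w := by
  have hA' : A.IsHermitian := by
    rwa [IsHermitian, conjTranspose_eq_transpose_of_trivial]
  obtain ⟨V, a, hV1, hV2, hVA⟩ : ∃ (V : Matrix ι ι ℝ) (a : ι → ℝ), V * Vᵀ = 1 ∧ Vᵀ * V = 1 ∧
      A = V * diagonal a * Vᵀ := by
    refine ⟨hA'.eigenvectorUnitary, hA'.eigenvalues, ?_, ?_, ?_⟩
    · simpa [star_eq_conjTranspose, conjTranspose_eq_transpose_of_trivial] using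
        Unitary.coe_mul_star_self hA'.eigenvectorUnitary
    · simpa [star_eq_conjTranspose, conjTranspose_eq_transpose_of_trivial] using
        Unitary.coe_star_mul_self hA'.eigenvectorUnitary
    · have := hA'.spectral_theorem
      rw [Unitary.conjStarAlgAut_apply] at this
      simpa [star_eq_conjTranspose, conjTranspose_eq_transpose_of_trivial,
        Function.comp_def] using this
  have hVinj : ∀ w, V *ᵥ w = 0 → w = 0 := fun w hw => by
    simpa [hV2] using congrArg (Vᵀ *ᵥ ·) hw
  have hVtinj : ∀ w, Vᵀ *ᵥ w = 0 → w = 0 := fun w hw => by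
    simpa [hV1] using congrArg (V *ᵥ ·) hw
  obtain ⟨K, hK, hpos⟩ := exists_skew_compensator_diagonal a (Vᵀ * B * V)
    (by simpa [conjTranspose_eq_transpose_of_trivial] using hB.conjTranspose_mul_mul_same V)
    (fun l w hw hw0 => by
      refine hVinj w (h l _ ?_ ?_)
      · rw [hVA, mulVec_mulVec, Matrix.mul_assoc, hV2, Matrix.mul_one, ← mulVec_mulVec, hw,
          mulVec_smul]
      · refine hVtinj _ ?_
        simpa [mulVec_mulVec, Matrix.mul_assoc] using hw0)
  refine ⟨V * K * Vᵀ, ?_, fun w hw => ?_⟩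
  · simp [transpose_mul, hK, Matrix.mul_assoc]
  · have h1 := hpos (Vᵀ *ᵥ w) (fun h0 => hw (hVtinj w h0))
    have hadj : ∀ y, Vᵀ *ᵥ w ⬝ᵥ y = w ⬝ᵥ V *ᵥ y := fun y => by
      rw [dotProduct_mulVec, ← mulVec_transpose]
    have e1 : Vᵀ *ᵥ w ⬝ᵥ (K * diagonal a) *ᵥ (Vᵀ *ᵥ w) = w ⬝ᵥ (V * K * Vᵀ * A) *ᵥ w := by
      rw [hadj, hVA]
      simp only [mulVec_mulVec]
      congr 2
      rw [show V * K * Vᵀ * (V * diagonal a * Vᵀ) = V * K * (Vᵀ * V) * diagonal a * Vᵀ by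
        simp only [Matrix.mul_assoc], hV2]
      simp only [Matrix.mul_assoc, Matrix.one_mul]
    have e2 : Vᵀ *ᵥ w ⬝ᵥ (Vᵀ * B * V) *ᵥ (Vᵀ *ᵥ w) = w ⬝ᵥ B *ᵥ w := by
      rw [hadj]
      simp only [mulVec_mulVec]
      congr 2
      rw [show V * (Vᵀ * B * V * Vᵀ) = (V * Vᵀ) * B * (V * Vᵀ) by
        simp only [Matrix.mul_assoc], hV1, Matrix.one_mul, Matrix.mul_one]
    rwa [e1, e2] at h1

theorem real_dotProduct_self_nonneg {ι : Type*} [Fintype ι] (v : ι → ℝ) : 0 ≤ v ⬝ᵥ v :=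
  sum_nonneg fun i _ => mul_self_nonneg (v i)

/-- A positive definite quadratic form on `ℝⁿ` is coercive. -/
theorem exists_coercive_of_pos {ι : Type*} [Fintype ι] (M : Matrix ι ι ℝ)
    (h : ∀ w : ι → ℝ, w ≠ 0 → 0 < w ⬝ᵥ M *ᵥ w) :
    ∃ c : ℝ, 0 < c ∧ ∀ w : ι → ℝ, c * (w ⬝ᵥ w) ≤ w ⬝ᵥ M *ᵥ w := by
  have hc : Continuous fun w : ι → ℝ => w ⬝ᵥ M *ᵥ w := by fun_prop
  have hc' : Continuous fun w : ι → ℝ => w ⬝ᵥ w := by fun_prop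
  have hpos : ∀ w : ι → ℝ, w ≠ 0 → 0 < w ⬝ᵥ w := fun w hw =>
    lt_of_le_of_ne (real_dotProduct_self_nonneg w) fun h0 => hw (dotProduct_self_eq_zero.1 h0.symm)
  have hne : ∀ w ∈ Metric.sphere (0 : ι → ℝ) 1, w ≠ 0 := fun w hw h0 => by simp [h0] at hw
  obtain ⟨c, hc0, hcs⟩ : ∃ c : ℝ, 0 < c ∧ ∀ w ∈ Metric.sphere (0 : ι → ℝ) 1,
      c ≤ (w ⬝ᵥ M *ᵥ w) / (w ⬝ᵥ w) :=
    (isCompact_sphere (0 : ι → ℝ) 1).exists_forall_le'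
      (hc.continuousOn.div hc'.continuousOn fun w hw => (hpos w (hne w hw)).ne')
      fun w hw => div_pos (h w (hne w hw)) (hpos w (hne w hw))
  refine ⟨c, hc0, fun w => ?_⟩
  by_cases hw : w = 0
  · simp [hw]
  have hn : ‖w‖ ≠ 0 := norm_ne_zero_iff.2 hw
  have h1 := hcs (‖w‖⁻¹ • w) (by simp [norm_smul, hn])
  have h2 : (‖w‖⁻¹ • w ⬝ᵥ M *ᵥ (‖w‖⁻¹ • w)) / (‖w‖⁻¹ • w ⬝ᵥ ‖w‖⁻¹ • w)
      = (w ⬝ᵥ M *ᵥ w) / (w ⬝ᵥ w) := by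
    simp only [mulVec_smul, smul_dotProduct, dotProduct_smul, smul_eq_mul]
    rw [← mul_assoc, ← mul_assoc, mul_div_mul_left]
    positivity
  rw [h2, le_div_iff₀ (hpos w hw)] at h1
  exact h1

theorem exists_mulVec_dotProduct_le {ι κ : Type*} [Fintype ι] [Fintype κ] (M : Matrix ι κ ℝ) :
    ∃ L : ℝ, 0 ≤ L ∧ ∀ v, M *ᵥ v ⬝ᵥ M *ᵥ v ≤ L * (v ⬝ᵥ v) := by
  refine ⟨∑ i, ∑ j, M i j ^ 2, by positivity, fun v => ?_⟩
  simp only [dotProduct, mulVec, sum_mul, ← pow_two]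
  refine sum_le_sum fun i _ => ?_
  rw [← sum_mul]
  exact sum_mul_sq_le_sq_mul_sq _ _ _

theorem two_mul_dotProduct_le {ι : Type*} [Fintype ι] {c : ℝ} (hc : 0 < c) (u v : ι → ℝ) :
    2 * (u ⬝ᵥ v) ≤ c * (v ⬝ᵥ v) + c⁻¹ * (u ⬝ᵥ u) := by
  simp only [dotProduct, mul_sum, ← sum_add_distrib]
  refine sum_le_sum fun i _ => ?_
  have h : c * (v i * v i) + c⁻¹ * (u i * u i) - 2 * (u i * v i) = c * (v i - c⁻¹ * u i) ^ 2 := by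
    field_simp
    ring
  have : 0 ≤ c * (v i - c⁻¹ * u i) ^ 2 := by positivity
  linarith

theorem pow_mulVec_of_eigen {ι : Type*} [Fintype ι] [DecidableEq ι] {A : Matrix ι ι ℝ} {l : ℝ}
    {w : ι → ℝ} (h : A *ᵥ w = l • w) (k : ℕ) : (A ^ k) *ᵥ w = l ^ k • w := by
  induction k with
  | zero => simp
  | succ k ih => rw [pow_succ, ← mulVec_mulVec, h, mulVec_smul, ih, smul_smul, pow_succ']

theorem dotProduct_Bmat_mulVec {n₁ n₂ : ℕ} (D : Matrix (Fin n₂) (Fin n₂) ℝ)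
    (u : Idx n₁ n₂ → ℝ) :
    u ⬝ᵥ Bmat D *ᵥ u = ∑ j, (D *ᵥ fun j => u (Sum.inr j)) j * u (Sum.inr j) := by
  rw [Bmat, fromBlocks_mulVec, dotProduct, Fintype.sum_sum_type]
  simp [Function.comp_def, mul_comm]

/-- Positivity and coercivity of the augmented energy and of its dissipation. -/
theorem exists_hypocoercive_form {n₁ n₂ : ℕ}
    (A : Matrix (Idx n₁ n₂) (Idx n₁ n₂) ℝ) (hA : A.IsSymm)
    (D : Matrix (Fin n₂) (Fin n₂) ℝ) (hDpos : D.PosDef) {κ : ℝ} (hκ : 0 < κ)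
    (hdiss : ∀ X : Fin n₂ → ℝ, κ * ∑ j, (X j) ^ 2 ≤ ∑ j, D.mulVec X j * X j)
    (hK : KalmanCondition A (Bmat D)) :
    ∃ (K : Matrix (Idx n₁ n₂) (Idx n₁ n₂) ℝ) (M c C : ℝ), Kᵀ = -K ∧ 0 < c ∧ 0 ≤ C ∧
      (∀ u v, u ⬝ᵥ u + v ⬝ᵥ v ≤ M * (u ⬝ᵥ u + v ⬝ᵥ v) + K *ᵥ u ⬝ᵥ v) ∧
      (∀ u v, M * (u ⬝ᵥ u + v ⬝ᵥ v) + K *ᵥ u ⬝ᵥ v ≤ C * (u ⬝ᵥ u + v ⬝ᵥ v)) ∧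
      ∀ u v, c * (∑ j, u (Sum.inr j) ^ 2 + v ⬝ᵥ v) ≤
        2 * M * (u ⬝ᵥ Bmat D *ᵥ u + v ⬝ᵥ Bmat D *ᵥ v)
          + 2 * (v ⬝ᵥ K *ᵥ (A *ᵥ v + Bmat D *ᵥ u)) := by
  have hlow : ∀ u : Idx n₁ n₂ → ℝ, κ * ∑ j, u (Sum.inr j) ^ 2 ≤ u ⬝ᵥ Bmat D *ᵥ u := fun u => by
    rw [dotProduct_Bmat_mulVec]
    exact hdiss fun j => u (Sum.inr j)
  have hnn : ∀ u : Idx n₁ n₂ → ℝ, 0 ≤ u ⬝ᵥ Bmat D *ᵥ u := fun u =>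
    le_trans (by positivity) (hlow u)
  have hB : (Bmat D : Matrix (Idx n₁ n₂) (Idx n₁ n₂) ℝ).PosSemidef := by
    refine PosSemidef.of_dotProduct_mulVec_nonneg ?_ fun x => by simpa using hnn x
    have := hDpos.isHermitian
    rw [IsHermitian] at this ⊢
    rw [Bmat, fromBlocks_conjTranspose, this]
    simp
  obtain ⟨K, hKs, hKpos⟩ := exists_skew_compensator A (Bmat D) hA hB fun l w hw hw0 =>
    hK w fun k _ => by rw [← mulVec_mulVec, pow_mulVec_of_eigen hw, mulVec_smul, hw0, smul_zero]
  obtain ⟨c, hc, hcoer⟩ := exists_coercive_of_pos (K * A + Bmat D) fun w hw => by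
    rw [add_mulVec, dotProduct_add]
    exact hKpos w hw
  obtain ⟨L, hL, hLK⟩ := exists_mulVec_dotProduct_le K
  obtain ⟨N, hN, hNKB⟩ := exists_mulVec_dotProduct_le (K *
    (fromRows 0 D : Matrix (Idx n₁ n₂) (Fin n₂) ℝ))
  have hKB : ∀ u : Idx n₁ n₂ → ℝ, K *ᵥ (Bmat D *ᵥ u) ⬝ᵥ K *ᵥ (Bmat D *ᵥ u)
      ≤ N * ∑ j, u (Sum.inr j) ^ 2 := fun u => by
    have h1 := hNKB fun j => u (Sum.inr j)
    have h2 : Bmat D *ᵥ u = (fromRows 0 D : Matrix (Idx n₁ n₂) (Fin n₂) ℝ) *ᵥ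
        fun j => u (Sum.inr j) := by
      rw [Bmat, fromBlocks_mulVec, fromRows_mulVec]
      simp [Function.comp_def]
    rw [h2, mulVec_mulVec]
    simp only [dotProduct, ← pow_two] at h1 ⊢
    exact h1
  set M : ℝ := 1 + L + (c⁻¹ * N + c) / κ with hM
  have hM0 : 0 ≤ (c⁻¹ * N + c) / κ := by positivity
  have hcross : ∀ u v : Idx n₁ n₂ → ℝ, |K *ᵥ u ⬝ᵥ v| ≤ (1 + L) * (u ⬝ᵥ u + v ⬝ᵥ v) := by
    intro u v
    have h1 := two_mul_dotProduct_le one_pos (K *ᵥ u) v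
    have h2 := two_mul_dotProduct_le one_pos (-(K *ᵥ u)) v
    have h3 := hLK u
    have h4 := real_dotProduct_self_nonneg u
    have h5 := real_dotProduct_self_nonneg v
    have h6 : 0 ≤ L * (u ⬝ᵥ u) := by positivity
    have h7 : 0 ≤ L * (v ⬝ᵥ v) := by positivity
    simp only [neg_dotProduct, dotProduct_neg, neg_neg, inv_one, one_mul] at h1 h2
    rw [abs_le]
    constructor <;> nlinarith
  refine ⟨K, M + 1, c, M + 1 + (1 + L), hKs, hc, by positivity, fun u v => ?_, fun u v => ?_,
    fun u v => ?_⟩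
  · have h1 := (abs_le.1 (hcross u v)).1
    have h2 : 0 ≤ (c⁻¹ * N + c) / κ * (u ⬝ᵥ u + v ⬝ᵥ v) :=
      mul_nonneg hM0 (add_nonneg (real_dotProduct_self_nonneg u) (real_dotProduct_self_nonneg v))
    rw [hM]
    linarith
  · have h1 := (abs_le.1 (hcross u v)).2
    linarith
  · have h1 := hcoer v
    have h2 := two_mul_dotProduct_le hc (-(K *ᵥ (Bmat D *ᵥ u))) v
    have h3 := hKB u
    have h4 := hlow u
    have h5 := hnn v
    have h6 := hnn u
    rw [add_mulVec, dotProduct_add, ← mulVec_mulVec] at h1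
    rw [neg_dotProduct, neg_dotProduct, dotProduct_neg, neg_neg, dotProduct_comm _ v] at h2
    rw [mulVec_add, dotProduct_add]
    have h7 : c⁻¹ * (K *ᵥ (Bmat D *ᵥ u) ⬝ᵥ K *ᵥ (Bmat D *ᵥ u)) + c * ∑ j, u (Sum.inr j) ^ 2
        ≤ (c⁻¹ * N + c) / κ * (u ⬝ᵥ Bmat D *ᵥ u) := by
      calc _ ≤ c⁻¹ * (N * ∑ j, u (Sum.inr j) ^ 2) + c * ∑ j, u (Sum.inr j) ^ 2 := by gcongr
        _ = (c⁻¹ * N + c) / κ * (κ * ∑ j, u (Sum.inr j) ^ 2) := by field_simp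
        _ ≤ _ := by gcongr
    have h8 : 0 ≤ (1 + L) * (u ⬝ᵥ Bmat D *ᵥ u) := by positivity
    have h9 : 0 ≤ (1 + L) * (v ⬝ᵥ Bmat D *ᵥ v) := by positivity
    have h10 : 0 ≤ (c⁻¹ * N + c) / κ * (v ⬝ᵥ Bmat D *ᵥ v) := by positivity
    have h11 : 0 ≤ (c⁻¹ * N + c) / κ * (u ⬝ᵥ Bmat D *ᵥ u) := by positivity
    rw [hM]
    linarith

/-- `f t x = O((1 + x²)⁻¹)`, uniformly for `t ∈ [0, T]`. -/
def DecaysOn {E : Type*} [Norm E] (T : ℝ) (f : ℝ → ℝ → E) : Prop :=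
  ∃ C : ℝ, 0 ≤ C ∧ ∀ t ∈ Set.Icc (0 : ℝ) T, ∀ x : ℝ, ‖f t x‖ ≤ C * (1 + x ^ 2)⁻¹

namespace DecaysOn

variable {T : ℝ}

theorem add {E : Type*} [SeminormedAddGroup E] {f g : ℝ → ℝ → E} (hf : DecaysOn T f)
    (hg : DecaysOn T g) : DecaysOn T fun t x => f t x + g t x := by
  obtain ⟨C, hC, hf⟩ := hf
  obtain ⟨C', hC', hg⟩ := hg
  refine ⟨C + C', by positivity, fun t ht x => (norm_add_le _ _).trans ?_⟩
  rw [add_mul]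
  exact add_le_add (hf t ht x) (hg t ht x)

theorem neg {E : Type*} [SeminormedAddGroup E] {f : ℝ → ℝ → E} (hf : DecaysOn T f) :
    DecaysOn T fun t x => -f t x := by
  simpa only [DecaysOn, norm_neg] using hf

theorem const_mul {f : ℝ → ℝ → ℝ} (c : ℝ) (hf : DecaysOn T f) :
    DecaysOn T fun t x => c * f t x := by
  obtain ⟨C, hC, hf⟩ := hf
  refine ⟨|c| * C, by positivity, fun t ht x => ?_⟩
  rw [norm_mul, Real.norm_eq_abs, mul_assoc]
  exact mul_le_mul_of_nonneg_left (hf t ht x) (abs_nonneg c)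

theorem mul {f g : ℝ → ℝ → ℝ} (hf : DecaysOn T f) (hg : DecaysOn T g) :
    DecaysOn T fun t x => f t x * g t x := by
  obtain ⟨C, hC, hf⟩ := hf
  obtain ⟨C', hC', hg⟩ := hg
  refine ⟨C * C', by positivity, fun t ht x => ?_⟩
  have hx : (1 + x ^ 2)⁻¹ ≤ 1 := inv_le_one_of_one_le₀ (by nlinarith [sq_nonneg x])
  have h1 : ‖g t x‖ ≤ C' := (hg t ht x).trans (mul_le_of_le_one_right hC' hx)
  calc ‖f t x * g t x‖ = ‖f t x‖ * ‖g t x‖ := norm_mul _ _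
    _ ≤ C * (1 + x ^ 2)⁻¹ * C' := by gcongr; exact hf t ht x
    _ = C * C' * (1 + x ^ 2)⁻¹ := by ring

theorem sum {κ : Type*} (s : Finset κ) {f : κ → ℝ → ℝ → ℝ} (hf : ∀ i ∈ s, DecaysOn T (f i)) :
    DecaysOn T fun t x => ∑ i ∈ s, f i t x := by
  classical
  induction s using Finset.induction_on with
  | empty => exact ⟨0, le_rfl, by simp⟩
  | insert a s ha ih =>
    simp only [sum_insert ha]
    exact (hf a (mem_insert_self a s)).add (ih fun i hi => hf i (mem_insert_of_mem hi))

theorem apply {ι : Type*} [Fintype ι] {f : ℝ → ℝ → ι → ℝ} (hf : DecaysOn T f) (i : ι) :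
    DecaysOn T fun t x => f t x i := by
  obtain ⟨C, hC, hf⟩ := hf
  exact ⟨C, hC, fun t ht x => (norm_le_pi_norm _ i).trans (hf t ht x)⟩

theorem dotProduct {ι : Type*} [Fintype ι] {f g : ℝ → ℝ → ι → ℝ} (hf : DecaysOn T f)
    (hg : DecaysOn T g) : DecaysOn T fun t x => f t x ⬝ᵥ g t x :=
  sum _ fun i _ => (hf.apply i).mul (hg.apply i)

theorem mulVec {ι κ : Type*} [Fintype ι] [Fintype κ] (M : Matrix ι κ ℝ) {f : ℝ → ℝ → κ → ℝ}
    (hf : DecaysOn T f) : DecaysOn T fun t x => M *ᵥ f t x := by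
  obtain ⟨C, hC, hf⟩ := hf
  set L := (Matrix.mulVecLin M).toContinuousLinearMap
  refine ⟨‖L‖ * C, by positivity, fun t ht x => (L.le_opNorm (f t x)).trans ?_⟩
  rw [mul_assoc]
  exact mul_le_mul_of_nonneg_left (hf t ht x) (norm_nonneg L)

theorem integrable {f : ℝ → ℝ → ℝ} (hf : DecaysOn T f) {t : ℝ} (ht : t ∈ Set.Icc 0 T)
    (hc : Continuous (f t)) : Integrable (f t) := by
  obtain ⟨C, hC, hf⟩ := hf
  exact (integrable_inv_one_add_sq.const_mul C).mono' hc.aestronglyMeasurable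
    (.of_forall (hf t ht))

end DecaysOn

theorem HasDerivAt.dotProduct {ι : Type*} [Fintype ι] {f g : ℝ → ι → ℝ} {f' g' : ι → ℝ} {x : ℝ}
    (hf : HasDerivAt f f' x) (hg : HasDerivAt g g' x) :
    HasDerivAt (fun y => f y ⬝ᵥ g y) (f' ⬝ᵥ g x + f x ⬝ᵥ g') x := by
  rw [hasDerivAt_pi] at hf hg
  simp only [_root_.dotProduct, ← sum_add_distrib]
  exact HasDerivAt.fun_sum fun i _ => (hf i).mul (hg i)

theorem HasDerivAt.mulVec {ι κ : Type*} [Fintype ι] [Fintype κ] (M : Matrix ι κ ℝ)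
    {f : ℝ → κ → ℝ} {f' : κ → ℝ} {x : ℝ} (hf : HasDerivAt f f' x) :
    HasDerivAt (fun y => M *ᵥ f y) (M *ᵥ f') x :=
  (Matrix.mulVecLin M).toContinuousLinearMap.hasFDerivAt.comp_hasDerivAt x hf

/-- Differentiation under the integral sign for uniformly decaying densities on a time interval. -/
theorem hasDerivAt_integral_of_decaysOn {T : ℝ} {e e' : ℝ → ℝ → ℝ} (hec : ∀ t, Continuous (e t))
    (he : DecaysOn T e) (he'c : ∀ t, Continuous (e' t)) (he' : DecaysOn T e')
    (hderiv : ∀ t ∈ Set.Icc 0 T, ∀ x, HasDerivAt (fun s => e s x) (e' t x) t) :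
    ContinuousOn (fun t => ∫ x, e t x) (Set.Icc 0 T) ∧
      ∀ t ∈ Set.Ioo 0 T, HasDerivAt (fun s => ∫ x, e s x) (∫ x, e' t x) t := by
  obtain ⟨C, hC, hb⟩ := id he
  obtain ⟨C', hC', hb'⟩ := he'
  refine ⟨continuousOn_of_dominated (bound := fun x => C * (1 + x ^ 2)⁻¹)
    (fun t _ => (hec t).aestronglyMeasurable) (fun t ht => .of_forall (hb t ht))
    (integrable_inv_one_add_sq.const_mul C)
    (.of_forall fun x t ht => (hderiv t ht x).continuousAt.continuousWithinAt), fun t ht => ?_⟩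
  exact (hasDerivAt_integral_of_dominated_loc_of_deriv_le (Icc_mem_nhds ht.1 ht.2)
    (.of_forall fun s => (hec s).aestronglyMeasurable)
    (he.integrable (Set.Ioo_subset_Icc_self ht) (hec t)) (he'c t).aestronglyMeasurable
    (.of_forall fun x s hs => hb' s hs x) (integrable_inv_one_add_sq.const_mul C')
    (.of_forall fun x s hs => hderiv s hs x)).2

namespace IsClassicalSolution

variable {n₁ n₂ : ℕ} {A : Matrix (Idx n₁ n₂) (Idx n₁ n₂) ℝ} {D : Matrix (Fin n₂) (Fin n₂) ℝ}
  {U : ℝ → ℝ → Idx n₁ n₂ → ℝ}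

theorem hasDerivAt_space_fderiv (hU : IsClassicalSolution A D U) (t x : ℝ) :
    HasDerivAt (U t) (fderiv ℝ (fun p : ℝ × ℝ => U p.1 p.2) (t, x) (0, 1)) x := by
  have h1 : HasFDerivAt (fun p : ℝ × ℝ => U p.1 p.2) _ (t, x) :=
    (hU.smooth.differentiable (by simp) _).hasFDerivAt
  exact h1.comp_hasDerivAt x ((hasDerivAt_const x t).prodMk (hasDerivAt_id x))

theorem hasDerivAt_time_fderiv (hU : IsClassicalSolution A D U) (t x : ℝ) :
    HasDerivAt (fun s => U s x) (fderiv ℝ (fun p : ℝ × ℝ => U p.1 p.2) (t, x) (1, 0)) t := by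
  have h1 : HasFDerivAt (fun p : ℝ × ℝ => U p.1 p.2) _ (t, x) :=
    (hU.smooth.differentiable (by simp) _).hasFDerivAt
  exact h1.comp_hasDerivAt t ((hasDerivAt_id t).prodMk (hasDerivAt_const t x))

theorem pdx_eq_fderiv (hU : IsClassicalSolution A D U) (t x : ℝ) :
    pdx U t x = fderiv ℝ (fun p : ℝ × ℝ => U p.1 p.2) (t, x) (0, 1) :=
  (hU.hasDerivAt_space_fderiv t x).deriv

theorem hasDerivAt_space (hU : IsClassicalSolution A D U) (t x : ℝ) :
    HasDerivAt (U t) (pdx U t x) x := by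
  rw [hU.pdx_eq_fderiv]
  exact hU.hasDerivAt_space_fderiv t x

theorem hasDerivAt_time (hU : IsClassicalSolution A D U) {t : ℝ} (ht : 0 ≤ t) (x : ℝ) :
    HasDerivAt (fun s => U s x) (-(A *ᵥ pdx U t x + Bmat D *ᵥ U t x)) t := by
  have h1 := hU.hasDerivAt_time_fderiv t x
  have h2 := hU.eqn t x ht
  rw [h1.deriv, add_assoc] at h2
  rwa [eq_neg_of_add_eq_zero_left h2] at h1

theorem continuous_space (hU : IsClassicalSolution A D U) (t : ℝ) : Continuous (U t) :=
  hU.smooth.continuous.comp (by fun_prop : Continuous fun x : ℝ => (t, x))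

theorem decaysOn (hU : IsClassicalSolution A D U) (T : ℝ) : DecaysOn T U := by
  obtain ⟨C₀, h₀⟩ := hU.decay 0 0 T
  obtain ⟨C₂, h₂⟩ := hU.decay 2 0 T
  refine ⟨|C₀| + |C₂|, by positivity, fun t ht x => ?_⟩
  have e0 := h₀ t ht x
  have e2 := h₂ t ht x
  simp only [iteratedDeriv_zero, pow_zero, one_mul, sq_abs] at e0 e2
  rw [← div_eq_mul_inv, le_div_iff₀ (by positivity)]
  linarith [le_abs_self C₀, le_abs_self C₂]

/-- The space derivative of a classical solution is a classical solution. -/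
theorem spaceDeriv (hU : IsClassicalSolution A D U) : IsClassicalSolution A D (pdx U) where
  smooth := by
    simp only [hU.pdx_eq_fderiv]
    exact (hU.smooth.fderiv_right (m := (⊤ : ℕ∞)) (by simp)).clm_apply contDiff_const
  decay k m T := by
    obtain ⟨C, hC⟩ := hU.decay k (m + 1) T
    refine ⟨C, fun t ht x => ?_⟩
    have := hC t ht x
    rwa [iteratedDeriv_succ'] at this
  eqn t x ht := by
    set G : ℝ × ℝ → Idx n₁ n₂ → ℝ := fun p => U p.1 p.2 with hG
    have hd : HasFDerivAt (fderiv ℝ G) (fderiv ℝ (fderiv ℝ G) (t, x)) (t, x) :=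
      ((hU.smooth.fderiv_right (m := (⊤ : ℕ∞)) (by simp)).differentiable (by simp) _).hasFDerivAt
    have hsymm : fderiv ℝ (fderiv ℝ G) (t, x) (1, 0) (0, 1)
        = fderiv ℝ (fderiv ℝ G) (t, x) (0, 1) (1, 0) :=
      (hU.smooth.contDiffAt.isSymmSndFDerivAt (by
        simpa using WithTop.coe_le_coe.2 (le_top : (2 : ℕ∞) ≤ ⊤))).eq _ _
    have hdx : ∀ v, HasDerivAt (fun y => fderiv ℝ G (t, y) v)
        (fderiv ℝ (fderiv ℝ G) (t, x) (0, 1) v) x := fun v =>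
      (ContinuousLinearMap.apply ℝ (Idx n₁ n₂ → ℝ) v).hasFDerivAt.comp_hasDerivAt x
        (hd.comp_hasDerivAt x ((hasDerivAt_const x t).prodMk (hasDerivAt_id x)))
    have h1 : HasDerivAt (fun s => pdx U s x) (fderiv ℝ (fderiv ℝ G) (t, x) (1, 0) (0, 1)) t := by
      simp only [hU.pdx_eq_fderiv]
      exact (ContinuousLinearMap.apply ℝ (Idx n₁ n₂ → ℝ) ((0, 1) : ℝ × ℝ)).hasFDerivAt.comp_hasDerivAt t
        (hd.comp_hasDerivAt t ((hasDerivAt_id t).prodMk (hasDerivAt_const t x)))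
    have h2 : HasDerivAt (pdx U t) (pdx (pdx U) t x) x := by
      have h3 := hdx (0, 1)
      simp only [hG, ← hU.pdx_eq_fderiv] at h3
      exact h3.differentiableAt.hasDerivAt
    have h4 := hdx (1, 0)
    have h5 : (fun y => fderiv ℝ G (t, y) (1, 0))
        = fun y => -(A *ᵥ pdx U t y + Bmat D *ᵥ U t y) := funext fun y =>
      (hU.hasDerivAt_time_fderiv t y).unique (hU.hasDerivAt_time ht y)
    rw [h5] at h4
    have h6 := h4.unique ((h2.mulVec A).add ((hU.hasDerivAt_space t x).mulVec (Bmat D))).neg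
    rw [h1.deriv, hsymm, h6, add_assoc, neg_add_cancel]

end IsClassicalSolution

theorem sqL2_eq_integral_dotProduct {ι : Type*} [Fintype ι] (f : ℝ → ι → ℝ) :
    sqL2 f = ∫ x, f x ⬝ᵥ f x := by
  simp only [sqL2, dotProduct, ← pow_two]

/-- The augmented energy is continuous and its time derivative is minus the integral of the
dissipation form. -/
theorem IsClassicalSolution.hasDerivAt_augmented_energy {n₁ n₂ : ℕ}
    {A : Matrix (Idx n₁ n₂) (Idx n₁ n₂) ℝ} {D : Matrix (Fin n₂) (Fin n₂) ℝ}
    {U : ℝ → ℝ → Idx n₁ n₂ → ℝ} (hU : IsClassicalSolution A D U) (hA : A.IsSymm)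
    {K : Matrix (Idx n₁ n₂) (Idx n₁ n₂) ℝ} (hK : Kᵀ = -K) (M T : ℝ) :
    ContinuousOn (fun t => ∫ x, (M * (U t x ⬝ᵥ U t x + pdx U t x ⬝ᵥ pdx U t x)
        + K *ᵥ U t x ⬝ᵥ pdx U t x)) (Set.Icc 0 T) ∧
      ∀ t ∈ Set.Ioo 0 T, HasDerivAt
        (fun t => ∫ x, (M * (U t x ⬝ᵥ U t x + pdx U t x ⬝ᵥ pdx U t x)
          + K *ᵥ U t x ⬝ᵥ pdx U t x))
        (-∫ x, (2 * M * (U t x ⬝ᵥ Bmat D *ᵥ U t x + pdx U t x ⬝ᵥ Bmat D *ᵥ pdx U t x)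
          + 2 * (pdx U t x ⬝ᵥ K *ᵥ (A *ᵥ pdx U t x + Bmat D *ᵥ U t x)))) t := by
  have hV := hU.spaceDeriv
  have hW := hV.spaceDeriv
  set V := pdx U
  set W := pdx V
  have cU := hU.continuous_space
  have cV := hV.continuous_space
  have cW := hW.continuous_space
  have dU := hU.decaysOn T
  have dV := hV.decaysOn T
  have dW := hW.decaysOn T
  set p : ℝ → ℝ → Idx n₁ n₂ → ℝ := fun t x => -(A *ᵥ V t x + Bmat D *ᵥ U t x) with hp
  set q : ℝ → ℝ → Idx n₁ n₂ → ℝ := fun t x => -(A *ᵥ W t x + Bmat D *ᵥ V t x) with hq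
  have cp : ∀ t, Continuous (p t) := fun t => by fun_prop
  have cq : ∀ t, Continuous (q t) := fun t => by fun_prop
  have dp : DecaysOn T p := ((dV.mulVec A).add (dU.mulVec (Bmat D))).neg
  have dq : DecaysOn T q := ((dW.mulVec A).add (dV.mulVec (Bmat D))).neg
  have hpx : ∀ t x, HasDerivAt (p t) (q t x) x := fun t x =>
    (((hV.hasDerivAt_space t x).mulVec A).add ((hU.hasDerivAt_space t x).mulVec (Bmat D))).neg
  set e' : ℝ → ℝ → ℝ := fun t x =>
    M * ((p t x ⬝ᵥ U t x + U t x ⬝ᵥ p t x) + (q t x ⬝ᵥ V t x + V t x ⬝ᵥ q t x))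
      + (K *ᵥ p t x ⬝ᵥ V t x + K *ᵥ U t x ⬝ᵥ q t x) with he'
  set r : ℝ → ℝ → ℝ := fun t x =>
    -(M * (U t x ⬝ᵥ A *ᵥ U t x + V t x ⬝ᵥ A *ᵥ V t x)) + K *ᵥ U t x ⬝ᵥ p t x
  set r' : ℝ → ℝ → ℝ := fun t x =>
    -(M * ((V t x ⬝ᵥ A *ᵥ U t x + U t x ⬝ᵥ A *ᵥ V t x)
      + (W t x ⬝ᵥ A *ᵥ V t x + V t x ⬝ᵥ A *ᵥ W t x)))
      + (K *ᵥ V t x ⬝ᵥ p t x + K *ᵥ U t x ⬝ᵥ q t x) with hr'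
  set d : ℝ → ℝ → ℝ := fun t x =>
    2 * M * (U t x ⬝ᵥ Bmat D *ᵥ U t x + V t x ⬝ᵥ Bmat D *ᵥ V t x)
      + 2 * (V t x ⬝ᵥ K *ᵥ (A *ᵥ V t x + Bmat D *ᵥ U t x)) with hd
  have hsplit : ∀ t x, e' t x = r' t x - d t x := by
    intro t x
    have hAs : ∀ u v : Idx n₁ n₂ → ℝ, v ⬝ᵥ A *ᵥ u = u ⬝ᵥ A *ᵥ v := fun u v => by
      rw [← Matrix.dotProduct_transpose_mulVec, hA.eq]
    have hKs : ∀ u v : Idx n₁ n₂ → ℝ, K *ᵥ u ⬝ᵥ v = -(u ⬝ᵥ K *ᵥ v) := fun u v => by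
      rw [dotProduct_comm, ← Matrix.dotProduct_transpose_mulVec, hK, neg_mulVec, dotProduct_neg]
    have hKp : K *ᵥ p t x ⬝ᵥ V t x = -(V t x ⬝ᵥ K *ᵥ (A *ᵥ V t x + Bmat D *ᵥ U t x)) := by
      rw [dotProduct_comm, hp, mulVec_neg, dotProduct_neg]
    have hKp' : K *ᵥ V t x ⬝ᵥ p t x = V t x ⬝ᵥ K *ᵥ (A *ᵥ V t x + Bmat D *ᵥ U t x) := by
      rw [hKs, hp, mulVec_neg, dotProduct_neg, neg_neg]
    have hVq : V t x ⬝ᵥ q t x = -(V t x ⬝ᵥ A *ᵥ W t x + V t x ⬝ᵥ Bmat D *ᵥ V t x) := by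
      rw [hq, dotProduct_neg, dotProduct_add]
    simp only [he', hr', hd, hKp, hKp']
    rw [dotProduct_comm (p t x), dotProduct_comm (q t x), hAs (U t x) (V t x),
      hAs (V t x) (W t x), hVq]
    simp only [hp, dotProduct_neg, dotProduct_add]
    ring
  have dr' : DecaysOn T r' :=
    ((((dV.dotProduct (dU.mulVec A)).add (dU.dotProduct (dV.mulVec A))).add
      ((dW.dotProduct (dV.mulVec A)).add (dV.dotProduct (dW.mulVec A)))).const_mul M).neg.add
      (((dV.mulVec K).dotProduct dp).add ((dU.mulVec K).dotProduct dq))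
  have dr : DecaysOn T r :=
    (((dU.dotProduct (dU.mulVec A)).add (dV.dotProduct (dV.mulVec A))).const_mul M).neg.add
      ((dU.mulVec K).dotProduct dp)
  have dd : DecaysOn T d :=
    (((dU.dotProduct (dU.mulVec (Bmat D))).add (dV.dotProduct (dV.mulVec (Bmat D)))).const_mul
      (2 * M)).add ((dV.dotProduct (((dV.mulVec A).add (dU.mulVec (Bmat D))).mulVec K)).const_mul 2)
  have de' : DecaysOn T e' :=
    ((((dp.dotProduct dU).add (dU.dotProduct dp)).add
      ((dq.dotProduct dV).add (dV.dotProduct dq))).const_mul M).add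
      (((dp.mulVec K).dotProduct dV).add ((dU.mulVec K).dotProduct dq))
  obtain ⟨h1, h2⟩ := hasDerivAt_integral_of_decaysOn (T := T) (e' := e')
    (e := fun t x => M * (U t x ⬝ᵥ U t x + V t x ⬝ᵥ V t x) + K *ᵥ U t x ⬝ᵥ V t x)
    (fun t => by fun_prop)
    ((((dU.dotProduct dU).add (dV.dotProduct dV)).const_mul M).add ((dU.mulVec K).dotProduct dV))
    (fun t => by fun_prop) de' fun t ht x => by
      have hUt := hU.hasDerivAt_time ht.1 x
      have hVt := hV.hasDerivAt_time ht.1 x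
      exact (((hUt.dotProduct hUt).add (hVt.dotProduct hVt)).const_mul M).add
        ((hUt.mulVec K).dotProduct hVt)
  refine ⟨h1, fun t ht => (h2 t ht).congr_deriv ?_⟩
  have ht' := Set.Ioo_subset_Icc_self ht
  have ir' : Integrable (r' t) := dr'.integrable ht' (by fun_prop)
  have ir : Integrable (r t) := dr.integrable ht' (by fun_prop)
  have id : Integrable (d t) := dd.integrable ht' (by fun_prop)
  have hr0 : ∫ x, r' t x = 0 := by
    refine integral_eq_zero_of_hasDerivAt_of_integrable (f := r t) (fun x => ?_) ir' ir
    have hUx := hU.hasDerivAt_space t x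
    have hVx := hV.hasDerivAt_space t x
    exact (((hUx.dotProduct (hUx.mulVec A)).add (hVx.dotProduct (hVx.mulVec A))).const_mul M).neg.add
      ((hUx.mulVec K).dotProduct (hpx t x))
  simp only [hsplit]
  rw [integral_sub ir' id, hr0, zero_sub]

/-- Integrated hypocoercivity estimate: under the Kalman rank
condition there is `C > 0` (depending only on `n, A, B, κ`) such that every classical
solution satisfies, for all `t ≥ 0`,
`‖U(t)‖²_{H¹} + ∫₀ᵗ (‖U₂(τ)‖²_{L²} + ‖∂ₓU(τ)‖²_{L²}) dτ ≤ C ‖U₀‖²_{H¹}`. -/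
theorem integrated_hypocoercivity
    {n₁ n₂ : ℕ} (hn₁ : 1 ≤ n₁) (hn₂ : 1 ≤ n₂)
    (A : Matrix (Idx n₁ n₂) (Idx n₁ n₂) ℝ) (hA : A.IsSymm)
    (D : Matrix (Fin n₂) (Fin n₂) ℝ) (hD : D.IsSymm) (hDpos : D.PosDef)
    (κ : ℝ) (hκ : 0 < κ)
    (hdiss : ∀ X : Fin n₂ → ℝ, κ * ∑ j, (X j) ^ 2 ≤ ∑ j, D.mulVec X j * X j)
    (hK : KalmanCondition A (Bmat D)) :
    ∃ C : ℝ, 0 < C ∧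
      ∀ U : ℝ → ℝ → Idx n₁ n₂ → ℝ, IsClassicalSolution A D U →
        ∀ t : ℝ, 0 ≤ t →
          sqH1 (U t) +
              ∫ τ in (0 : ℝ)..t, (sqL2 (U2part U τ) + sqL2 (fun x => pdx U τ x)) ≤
            C * sqH1 (U 0) := by
  obtain ⟨K, M, c, C, hKs, hc, hC, hlow, hup, hdis⟩ :=
    exists_hypocoercive_form A hA D hDpos hκ hdiss hK
  refine ⟨(1 + c⁻¹) * C + 1, by positivity, fun U hU t ht => ?_⟩
  obtain ⟨hcont, hder⟩ := hU.hasDerivAt_augmented_energy hA hKs M t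
  have dU := hU.decaysOn t
  have dV := hU.spaceDeriv.decaysOn t
  have cU := hU.continuous_space
  have cV := hU.spaceDeriv.continuous_space
  set V := pdx U
  set F : ℝ → ℝ := fun t => ∫ x, (M * (U t x ⬝ᵥ U t x + V t x ⬝ᵥ V t x) + K *ᵥ U t x ⬝ᵥ V t x)
  set g : ℝ → ℝ := fun τ => sqL2 (U2part U τ) + sqL2 (V τ)
  have iU : ∀ s ∈ Set.Icc 0 t, Integrable fun x => U s x ⬝ᵥ U s x := fun s hs =>
    (dU.dotProduct dU).integrable hs (by fun_prop)
  have iV : ∀ s ∈ Set.Icc 0 t, Integrable fun x => V s x ⬝ᵥ V s x := fun s hs =>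
    (dV.dotProduct dV).integrable hs (by fun_prop)
  have iF : ∀ s ∈ Set.Icc 0 t, Integrable fun x =>
      M * (U s x ⬝ᵥ U s x + V s x ⬝ᵥ V s x) + K *ᵥ U s x ⬝ᵥ V s x := fun s hs =>
    ((((dU.dotProduct dU).add (dV.dotProduct dV)).const_mul M).add
      ((dU.mulVec K).dotProduct dV)).integrable hs (by fun_prop)
  have hH : ∀ s ∈ Set.Icc 0 t, sqH1 (U s) = ∫ x, (U s x ⬝ᵥ U s x + V s x ⬝ᵥ V s x) :=
    fun s hs => by
      rw [integral_add (iU s hs) (iV s hs), sqH1, sqL2_eq_integral_dotProduct,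
        sqL2_eq_integral_dotProduct]
      rfl
  have hHF : ∀ s ∈ Set.Icc 0 t, sqH1 (U s) ≤ F s := fun s hs => by
    rw [hH s hs]
    exact integral_mono ((iU s hs).add (iV s hs)) (iF s hs) fun x => hlow _ _
  have hFH : ∀ s ∈ Set.Icc 0 t, F s ≤ C * sqH1 (U s) := fun s hs => by
    rw [hH s hs, ← integral_const_mul]
    exact integral_mono (iF s hs) (((iU s hs).add (iV s hs)).const_mul C) fun x => hup _ _
  have hL2 : ∀ {ι : Type} [Fintype ι] (f : ℝ → ι → ℝ), 0 ≤ sqL2 f := fun f =>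
    integral_nonneg fun x => sum_nonneg fun i _ => sq_nonneg _
  have hg0 : ∀ s, 0 ≤ g s := fun s => add_nonneg (hL2 _) (hL2 _)
  have hH0 : ∀ s, 0 ≤ sqH1 (U s) := fun s => add_nonneg (hL2 _) (hL2 _)
  have hdg : ∀ s ∈ Set.Ioo 0 t,
      -∫ x, (2 * M * (U s x ⬝ᵥ Bmat D *ᵥ U s x + V s x ⬝ᵥ Bmat D *ᵥ V s x)
        + 2 * (V s x ⬝ᵥ K *ᵥ (A *ᵥ V s x + Bmat D *ᵥ U s x))) ≤ -c * g s := fun s hs => by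
    have hs' := Set.Ioo_subset_Icc_self hs
    have iU2 : Integrable fun x => ∑ j, U s x (Sum.inr j) ^ 2 := by
      have := (DecaysOn.sum univ fun (j : Fin n₂) _ =>
        (dU.apply (Sum.inr j)).mul (dU.apply (Sum.inr j))).integrable hs' (by fun_prop)
      simpa only [← pow_two] using this
    have e1 : c * g s = ∫ x, c * (∑ j, U s x (Sum.inr j) ^ 2 + V s x ⬝ᵥ V s x) := by
      rw [integral_const_mul, integral_add iU2 (iV s hs'), ← sqL2_eq_integral_dotProduct]
      rfl
    rw [neg_mul, neg_le_neg_iff, e1]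
    refine integral_mono ((iU2.add (iV s hs')).const_mul c) ?_ fun x => hdis _ _
    exact ((((dU.dotProduct (dU.mulVec (Bmat D))).add
      (dV.dotProduct (dV.mulVec (Bmat D)))).const_mul (2 * M)).add
      ((dV.dotProduct (((dV.mulVec A).add (dU.mulVec (Bmat D))).mulVec K)).const_mul
        2)).integrable hs' (by fun_prop)
  have h0mem : (0 : ℝ) ∈ Set.Icc 0 t := Set.left_mem_Icc.2 ht
  have htmem : t ∈ Set.Icc 0 t := Set.right_mem_Icc.2 ht
  have hFt : F t ≤ F 0 := by
    have := intervalIntegral.sub_le_integral_of_hasDeriv_right_of_le ht hcont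
      (fun s hs => (hder s hs).hasDerivWithinAt) (φ := fun _ => 0) integrableOn_zero
      fun s hs => (hdg s hs).trans (by nlinarith [hg0 s])
    simpa using this
  have hint : c * ∫ τ in (0 : ℝ)..t, g τ ≤ F 0 := by
    by_cases hgi : IntervalIntegrable g volume 0 t
    · have := intervalIntegral.sub_le_integral_of_hasDeriv_right_of_le ht hcont
        (fun s hs => (hder s hs).hasDerivWithinAt) (φ := fun s => -c * g s)
        (((intervalIntegrable_iff_integrableOn_Icc_of_le ht).1 hgi).const_mul (-c)) hdg
      rw [intervalIntegral.integral_const_mul] at this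
      linarith [hHF t htmem, hH0 t]
    · rw [intervalIntegral.integral_undef hgi, mul_zero]
      exact (hH0 0).trans (hHF 0 h0mem)
  have hint' : ∫ τ in (0 : ℝ)..t, g τ ≤ c⁻¹ * F 0 := by
    rwa [inv_mul_eq_div, le_div_iff₀' hc]
  calc sqH1 (U t) + ∫ τ in (0 : ℝ)..t, g τ ≤ F 0 + c⁻¹ * F 0 :=
        add_le_add ((hHF t htmem).trans hFt) hint'
    _ = (1 + c⁻¹) * F 0 := by ring
    _ ≤ (1 + c⁻¹) * (C * sqH1 (U 0)) := by
        gcongr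
        exact hFH 0 h0mem
    _ ≤ ((1 + c⁻¹) * C + 1) * sqH1 (U 0) := by linarith [hH0 0]
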